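/- arXiv:2202.10352 — 4 statements merged into one kernel-verified Lean document; each statement's English description precedes it below -/
import Mathlib

section
/- Let u, v, w, z be real numbers with u > 1, v > 0, w > 0, z > 0. Let Y ~ Gamma(u, v), Y' ~ Gamma(u−1, v) and X ~ Gamma(w, z) be random variables such that Y is independent of X and Y' is independent of X. Then P(Y > X) = P(Y' > X) + (Γ(u+w−1)/(Γ(u)·Γ(w))) · (v/(v+z))^(u−1) · (z/(v+z))^w. -/
open MeasureTheory ProbabilityTheory

lemma integrable_gammaPDFReal {a r : ℝ} (ha : 0 < a) (hr : 0 < r) :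
    Integrable (gammaPDFReal a r) := by
  refine ⟨(measurable_gammaPDFReal a r).aestronglyMeasurable, ?_⟩
  rw [hasFiniteIntegral_iff_ofReal (ae_of_all _ (gammaPDFReal_nonneg ha hr))]
  exact (lintegral_gammaPDF_eq_one ha hr).trans_lt ENNReal.one_lt_top

lemma gammaMeasure_Ioi_eq_ofReal_integral {a r : ℝ} (ha : 0 < a) (hr : 0 < r) (x : ℝ) :
    gammaMeasure a r (Set.Ioi x) = ENNReal.ofReal (∫ t in Set.Ioi x, gammaPDFReal a r t) := by
  rw [gammaMeasure, withDensity_apply _ measurableSet_Ioi,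
    ofReal_integral_eq_lintegral_ofReal (integrable_gammaPDFReal ha hr).integrableOn
      (ae_of_all _ (gammaPDFReal_nonneg ha hr))]
  rfl

lemma hasDerivAt_gammaPDFReal {a r t : ℝ} (ha : 1 < a) (hr : 0 < r) (ht : 0 < t) :
    HasDerivAt (gammaPDFReal a r) (r * (gammaPDFReal (a - 1) r t - gammaPDFReal a r t)) t := by
  have heq : (fun x ↦ r ^ a / Real.Gamma a * x ^ (a - 1) * Real.exp (-(r * x)))
      =ᶠ[nhds t] gammaPDFReal a r := by
    filter_upwards [lt_mem_nhds ht] with x hx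
    rw [gammaPDFReal, if_pos hx.le]
  refine HasDerivAt.congr_of_eventuallyEq ?_ heq.symm
  have hexp := ((hasDerivAt_id t).const_mul r).neg.exp
  have hpow := (Real.hasDerivAt_rpow_const (p := a - 1) (Or.inl ht.ne')).const_mul
    (r ^ a / Real.Gamma a)
  refine (hpow.mul hexp).congr_deriv ?_
  have hG : Real.Gamma a = (a - 1) * Real.Gamma (a - 1) := by
    simpa using Real.Gamma_add_one (s := a - 1) (by linarith)
  have hGpos : Real.Gamma (a - 1) ≠ 0 := (Real.Gamma_pos_of_pos (by linarith)).ne'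
  have ha' : a - 1 ≠ 0 := by linarith
  have hra : r ^ a = r * r ^ (a - 1) := by
    rw [Real.rpow_sub_one hr.ne']; field_simp
  simp only [gammaPDFReal, if_pos ht.le, hG, hra, id, Pi.neg_apply, mul_one]
  field_simp
  ring

lemma tendsto_gammaPDFReal_atTop (a : ℝ) {r : ℝ} (hr : 0 < r) :
    Filter.Tendsto (gammaPDFReal a r) Filter.atTop (nhds 0) := by
  have h := (tendsto_rpow_mul_exp_neg_mul_atTop_nhds_zero (a - 1) r hr).const_mul
    (r ^ a / Real.Gamma a)
  rw [mul_zero] at h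
  refine h.congr' ?_
  filter_upwards [Filter.eventually_ge_atTop 0] with x hx
  rw [gammaPDFReal, if_pos hx, neg_mul, mul_assoc]

lemma gammaMeasure_Ioi_rec {a r x : ℝ} (ha : 1 < a) (hr : 0 < r) (hx : 0 < x) :
    gammaMeasure a r (Set.Ioi x) =
      gammaMeasure (a - 1) r (Set.Ioi x) + ENNReal.ofReal (r⁻¹ * gammaPDFReal a r x) := by
  have ha0 : 0 < a := by linarith
  have ha1 : 0 < a - 1 := by linarith
  have hi := (integrable_gammaPDFReal ha0 hr).integrableOn (s := Set.Ioi x)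
  have hi' := (integrable_gammaPDFReal ha1 hr).integrableOn (s := Set.Ioi x)
  have hftc := integral_Ioi_of_hasDerivAt_of_tendsto'
    (fun t (ht : t ∈ Set.Ici x) ↦ hasDerivAt_gammaPDFReal ha hr (hx.trans_le ht))
    ((hi'.sub hi).const_mul r) (tendsto_gammaPDFReal_atTop a hr)
  rw [integral_const_mul, integral_sub hi' hi] at hftc
  rw [gammaMeasure_Ioi_eq_ofReal_integral ha0 hr, gammaMeasure_Ioi_eq_ofReal_integral ha1 hr,
    ← ENNReal.ofReal_add (integral_nonneg (gammaPDFReal_nonneg ha1 hr))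
      (mul_nonneg (inv_nonneg.2 hr.le) (gammaPDFReal_nonneg ha0 hr x))]
  congr 1
  field_simp
  linarith

lemma ae_pos_gammaMeasure (a r : ℝ) : ∀ᵐ x ∂gammaMeasure a r, 0 < x := by
  rw [gammaMeasure, ae_withDensity_iff (by unfold gammaPDF; fun_prop)]
  filter_upwards [Measure.ae_ne volume (0 : ℝ)] with x hx h
  by_contra! hneg
  exact h (gammaPDF_of_neg (lt_of_le_of_ne hneg hx))

lemma gammaPDFReal_mul_gammaPDFReal {u v w z x : ℝ} (hv : 0 < v) (hz : 0 < z)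
    (huw : 0 < u + w - 1) (hx : 0 < x) :
    gammaPDFReal w z x * (v⁻¹ * gammaPDFReal u v x) =
      (Real.Gamma (u + w - 1) / (Real.Gamma u * Real.Gamma w)) *
          (v / (v + z)) ^ (u - 1) * (z / (v + z)) ^ w * gammaPDFReal (u + w - 1) (v + z) x := by
  have hvz : 0 < v + z := by positivity
  have hG := (Real.Gamma_pos_of_pos huw).ne'
  have hvu : v ^ u = v * v ^ (u - 1) := by
    rw [Real.rpow_sub_one hv.ne']; field_simp
  have hpow : x ^ (u + w - 1 - 1) = x ^ (u - 1) * x ^ (w - 1) := by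
    rw [← Real.rpow_add hx]; ring_nf
  have hsum : (v + z) ^ (u + w - 1) = (v + z) ^ (u - 1) * (v + z) ^ w := by
    rw [← Real.rpow_add hvz]; ring_nf
  have hexp : Real.exp (-((v + z) * x)) = Real.exp (-(v * x)) * Real.exp (-(z * x)) := by
    rw [← Real.exp_add]; ring_nf
  simp only [gammaPDFReal, if_pos hx.le]
  rw [Real.div_rpow hv.le hvz.le, Real.div_rpow hz.le hvz.le, hpow, hsum, hexp, hvu]
  have h1 := (Real.rpow_pos_of_pos hvz (u - 1)).ne'
  have h2 := (Real.rpow_pos_of_pos hvz w).ne'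
  field_simp

lemma lintegral_gammaPDFReal_gammaMeasure {u v w z : ℝ} (hu : 0 < u) (hv : 0 < v)
    (hw : 0 < w) (hz : 0 < z) (huw : 0 < u + w - 1) :
    ∫⁻ x, ENNReal.ofReal (v⁻¹ * gammaPDFReal u v x) ∂gammaMeasure w z =
      ENNReal.ofReal ((Real.Gamma (u + w - 1) / (Real.Gamma u * Real.Gamma w)) *
          (v / (v + z)) ^ (u - 1) * (z / (v + z)) ^ w) := by
  rw [gammaMeasure, lintegral_withDensity_eq_lintegral_mul _ (by unfold gammaPDF; fun_prop)
    (by fun_prop)]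
  have hK : 0 ≤ (Real.Gamma (u + w - 1) / (Real.Gamma u * Real.Gamma w)) *
      (v / (v + z)) ^ (u - 1) * (z / (v + z)) ^ w := by positivity
  calc
    _ = ∫⁻ x, ENNReal.ofReal ((Real.Gamma (u + w - 1) / (Real.Gamma u * Real.Gamma w)) *
          (v / (v + z)) ^ (u - 1) * (z / (v + z)) ^ w) * gammaPDF (u + w - 1) (v + z) x := by
      refine lintegral_congr_ae ?_
      filter_upwards [Measure.ae_ne volume (0 : ℝ)] with x hx
      rcases hx.lt_or_gt with hx | hx
      · simp [gammaPDF_of_neg hx]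
      · rw [Pi.mul_apply, gammaPDF, gammaPDF, ← ENNReal.ofReal_mul hK,
          ← ENNReal.ofReal_mul (gammaPDFReal_nonneg hw hz x),
          gammaPDFReal_mul_gammaPDFReal hv hz huw hx]
    _ = _ := by
      rw [lintegral_const_mul _ (by unfold gammaPDF; fun_prop),
        lintegral_gammaPDF_eq_one huw (by positivity), mul_one]

/-- Recursion for the probability that a `Gamma(u, v)` random variable exceeds an
independent `Gamma(w, z)` random variable, where `u > 1`:
`P(Y > X) = P(Y' > X) + Γ(u+w−1)/(Γ(u)Γ(w)) · (v/(v+z))^(u−1) · (z/(v+z))^w`,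
with `Y ~ Gamma(u,v)`, `Y' ~ Gamma(u−1,v)`, `X ~ Gamma(w,z)`. -/
theorem gamma_exceed_prob_rec (u v w z : ℝ) (hu : 1 < u) (hv : 0 < v)
    (hw : 0 < w) (hz : 0 < z) :
    (((gammaMeasure u v).prod (gammaMeasure w z)) {p : ℝ × ℝ | p.2 < p.1}).toReal =
      (((gammaMeasure (u - 1) v).prod (gammaMeasure w z)) {p : ℝ × ℝ | p.2 < p.1}).toReal +
        (Real.Gamma (u + w - 1) / (Real.Gamma u * Real.Gamma w)) *
          (v / (v + z)) ^ (u - 1) * (z / (v + z)) ^ w := by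
  have hu0 : 0 < u := by linarith
  have hu1 : 0 < u - 1 := by linarith
  have huw : 0 < u + w - 1 := by linarith
  have := isProbabilityMeasure_gammaMeasure hu0 hv
  have := isProbabilityMeasure_gammaMeasure hu1 hv
  have := isProbabilityMeasure_gammaMeasure hw hz
  have hs : MeasurableSet {p : ℝ × ℝ | p.2 < p.1} :=
    measurableSet_lt measurable_snd measurable_fst
  have key : (gammaMeasure u v).prod (gammaMeasure w z) {p : ℝ × ℝ | p.2 < p.1} =
      (gammaMeasure (u - 1) v).prod (gammaMeasure w z) {p : ℝ × ℝ | p.2 < p.1} +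
        ENNReal.ofReal ((Real.Gamma (u + w - 1) / (Real.Gamma u * Real.Gamma w)) *
          (v / (v + z)) ^ (u - 1) * (z / (v + z)) ^ w) := by
    rw [Measure.prod_apply_symm hs, Measure.prod_apply_symm hs,
      ← lintegral_gammaPDFReal_gammaMeasure hu0 hv hw hz huw,
      ← lintegral_add_right _ (by fun_prop)]
    refine lintegral_congr_ae ?_
    filter_upwards [ae_pos_gammaMeasure w z] with x hx
    exact gammaMeasure_Ioi_rec hu hv hx
  rw [key, ENNReal.toReal_add (measure_ne_top _ _) ENNReal.ofReal_ne_top,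
    ENNReal.toReal_ofReal (by positivity)]
end

section
/- Let u be a positive integer and let v, w, z be real numbers with v > 0, w > 0, z > 0. Let Y ~ Gamma(u, v) and X ~ Gamma(w, z) be independent random variables. Then P(Y > X) = Σ_{k=0}^{u−1} (Γ(k+w)/(Γ(k+1)·Γ(w))) · (v/(v+z))^k · (z/(v+z))^w. -/
open MeasureTheory ProbabilityTheory

/-- The Poisson lower tail `t ↦ ∑ k ≤ n, e^{-vt} (vt)^k / k!` is minus a primitive of the density
of the Gamma distribution with shape `n + 1` and rate `v`. -/
lemma hasDerivAt_neg_sum_exp_mul_pow_div_factorial (n : ℕ) (v t : ℝ) :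
    HasDerivAt
      (fun t : ℝ ↦ -∑ k ∈ Finset.range (n + 1), Real.exp (-(v * t)) * (v * t) ^ k / k.factorial)
      (v ^ (n + 1) / n.factorial * t ^ n * Real.exp (-(v * t))) t := by
  have hlin : HasDerivAt (fun t : ℝ ↦ v * t) v t := by
    simpa using (hasDerivAt_id t).const_mul v
  induction n with
  | zero =>
    have h := hlin.neg.exp.neg
    simp only [zero_add, Finset.sum_range_one, pow_zero, mul_one, Nat.factorial_zero,
      Nat.cast_one, div_one, pow_one]
    refine h.congr_deriv ?_
    simp
    ring
  | succ n ih =>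
    have h := ih.sub ((hlin.neg.exp.mul (hlin.pow (n + 1))).div_const ((n + 1).factorial : ℝ))
    refine (h.congr_of_eventuallyEq (.of_forall fun s ↦ ?_)).congr_deriv ?_
    · rw [Finset.sum_range_succ]
      simp
      ring
    · have : (n.factorial : ℝ) ≠ 0 := by positivity
      have : (n : ℝ) + 1 ≠ 0 := by positivity
      simp only [Nat.factorial_succ, Nat.cast_mul, Nat.cast_add, Nat.cast_one,
        add_tsub_cancel_right, Pi.neg_apply, Pi.pow_apply]
      field_simp
      ring

lemma tendsto_exp_mul_pow_div_factorial_atTop (k : ℕ) {v : ℝ} (hv : 0 < v) :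
    Filter.Tendsto (fun t : ℝ ↦ Real.exp (-(v * t)) * (v * t) ^ k / k.factorial)
      Filter.atTop (nhds 0) := by
  have h := ((Real.tendsto_pow_mul_exp_neg_atTop_nhds_zero k).comp
    (Filter.tendsto_id.const_mul_atTop hv)).div_const (k.factorial : ℝ)
  simpa [Function.comp_def, mul_comm] using h

lemma gammaMeasure_natCast_add_one_Ioi (n : ℕ) {v x : ℝ} (hv : 0 < v) (hx : 0 ≤ x) :
    gammaMeasure ((n : ℝ) + 1) v (Set.Ioi x) = ENNReal.ofReal
      (∑ k ∈ Finset.range (n + 1), Real.exp (-(v * x)) * (v * x) ^ k / k.factorial) := by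
  have hderiv := fun t (_ : t ∈ Set.Ici x) ↦
    hasDerivAt_neg_sum_exp_mul_pow_div_factorial n v t
  have hnonneg : ∀ t ∈ Set.Ioi x,
      0 ≤ v ^ (n + 1) / n.factorial * t ^ n * Real.exp (-(v * t)) := fun t ht ↦ by
    have : 0 < t := hx.trans_lt ht
    positivity
  have hlim := (tendsto_finsetSum (Finset.range (n + 1))
    fun k _ ↦ tendsto_exp_mul_pow_div_factorial_atTop k hv).neg
  rw [Finset.sum_const_zero, neg_zero] at hlim
  have hint := integrableOn_Ioi_deriv_of_nonneg' hderiv hnonneg hlim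
  have hval := integral_Ioi_of_hasDerivAt_of_nonneg' hderiv hnonneg hlim
  rw [zero_sub, neg_neg] at hval
  rw [← hval, ofReal_integral_eq_lintegral_ofReal hint
    ((ae_restrict_iff' measurableSet_Ioi).2 (.of_forall hnonneg)),
    gammaMeasure, withDensity_apply _ measurableSet_Ioi]
  refine setLIntegral_congr_fun measurableSet_Ioi fun t ht ↦ ?_
  have ht0 : 0 ≤ t := hx.trans (le_of_lt ht)
  simp only [gammaPDF_of_nonneg ht0, Real.Gamma_nat_eq_factorial, add_sub_cancel_right,
    Real.rpow_natCast]
  rw [← Nat.cast_add_one, Real.rpow_natCast]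

/-- The product of a Poisson weight with mean `v * x` and a Gamma density is a negative binomial
weight times a Gamma density. -/
lemma exp_mul_pow_div_factorial_mul_gammaPDFReal (k : ℕ) {v w z x : ℝ} (hv : 0 < v) (hw : 0 < w)
    (hz : 0 < z) (hx : 0 < x) :
    Real.exp (-(v * x)) * (v * x) ^ k / k.factorial * gammaPDFReal w z x =
      (Real.Gamma (k + w) / (Real.Gamma (k + 1) * Real.Gamma w)) *
        (v / (v + z)) ^ k * (z / (v + z)) ^ w * gammaPDFReal (k + w) (v + z) x := by
  have hvz : 0 < v + z := by positivity
  have hΓ : Real.Gamma (k + w) ≠ 0 := (Real.Gamma_pos_of_pos (by positivity)).ne'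
  have hΓw : Real.Gamma w ≠ 0 := (Real.Gamma_pos_of_pos hw).ne'
  have hvzw : (v + z) ^ w ≠ 0 := (Real.rpow_pos_of_pos hvz w).ne'
  have hexp : Real.exp (-((v + z) * x)) = Real.exp (-(v * x)) * Real.exp (-(z * x)) := by
    rw [← Real.exp_add]
    ring_nf
  have hpow : x ^ ((k : ℝ) + w - 1) = x ^ k * x ^ (w - 1) := by
    rw [add_sub_assoc, Real.rpow_add hx, Real.rpow_natCast]
  simp only [gammaPDFReal, if_pos hx.le, Real.Gamma_nat_eq_factorial]
  rw [hexp, hpow, Real.rpow_add hvz, Real.rpow_natCast, Real.div_rpow hz.le hvz.le, div_pow,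
    mul_pow]
  field_simp

/-- For a positive integer `u` and independent `Y ~ Gamma(u, v)`, `X ~ Gamma(w, z)`:
`P(Y > X) = Σ_{k=0}^{u−1} Γ(k+w)/(Γ(k+1)Γ(w)) · (v/(v+z))^k · (z/(v+z))^w`. -/
theorem gamma_exceed_prob_sum (u : ℕ) (hu : 0 < u) (v w z : ℝ) (hv : 0 < v)
    (hw : 0 < w) (hz : 0 < z) :
    (((gammaMeasure (u : ℝ) v).prod (gammaMeasure w z)) {p : ℝ × ℝ | p.2 < p.1}).toReal =
      ∑ k ∈ Finset.range u,
        (Real.Gamma (k + w) / (Real.Gamma (k + 1) * Real.Gamma w)) *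
          (v / (v + z)) ^ k * (z / (v + z)) ^ w := by
  have hvz : 0 < v + z := by positivity
  obtain ⟨n, rfl⟩ := Nat.exists_eq_add_one.2 hu
  have hprobY : IsProbabilityMeasure (gammaMeasure ((n + 1 : ℕ) : ℝ) v) :=
    isProbabilityMeasure_gammaMeasure (by positivity) hv
  have hprobX : IsProbabilityMeasure (gammaMeasure w z) := isProbabilityMeasure_gammaMeasure hw hz
  set c : ℕ → ℝ := fun k ↦ (Real.Gamma (k + w) / (Real.Gamma (k + 1) * Real.Gamma w)) *
    (v / (v + z)) ^ k * (z / (v + z)) ^ w with hc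
  have hc0 (k : ℕ) : 0 ≤ c k := by
    have := Real.Gamma_pos_of_pos hw
    have := Real.Gamma_pos_of_pos (show 0 < (k : ℝ) + w by positivity)
    have := Real.Gamma_pos_of_pos (show 0 < (k : ℝ) + 1 by positivity)
    simp only [hc]
    positivity
  have hmeas (a r : ℝ) : Measurable (gammaPDF a r) := (measurable_gammaPDFReal a r).ennreal_ofReal
  have htail : Measurable fun x ↦ gammaMeasure ((n + 1 : ℕ) : ℝ) v (Set.Ioi x) :=
    Antitone.measurable fun _ _ h ↦ measure_mono (Set.Ioi_subset_Ioi h)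
  have hdens : ∀ᵐ x : ℝ, gammaPDF w z x * gammaMeasure ((n + 1 : ℕ) : ℝ) v (Set.Ioi x) =
      ∑ k ∈ Finset.range (n + 1), ENNReal.ofReal (c k) * gammaPDF (k + w) (v + z) x := by
    filter_upwards [Measure.ae_ne volume (0 : ℝ)] with x hx
    rcases hx.lt_or_gt with hx | hx
    · simp [gammaPDF_of_neg hx]
    · rw [Nat.cast_add_one, gammaMeasure_natCast_add_one_Ioi n hv hx.le, gammaPDF,
        ← ENNReal.ofReal_mul (gammaPDFReal_nonneg hw hz x), mul_comm, Finset.sum_mul,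
        ENNReal.ofReal_sum_of_nonneg fun k _ ↦
          mul_nonneg (by positivity) (gammaPDFReal_nonneg hw hz x)]
      refine Finset.sum_congr rfl fun k _ ↦ ?_
      rw [exp_mul_pow_div_factorial_mul_gammaPDFReal k hv hw hz hx, gammaPDF,
        ← ENNReal.ofReal_mul (hc0 k)]
  have hset : MeasurableSet {p : ℝ × ℝ | p.2 < p.1} := measurableSet_lt measurable_snd measurable_fst
  have hprod : ((gammaMeasure ((n + 1 : ℕ) : ℝ) v).prod (gammaMeasure w z))
      {p : ℝ × ℝ | p.2 < p.1} = ENNReal.ofReal (∑ k ∈ Finset.range (n + 1), c k) :=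
    calc _ = ∫⁻ x, gammaMeasure ((n + 1 : ℕ) : ℝ) v (Set.Ioi x) ∂gammaMeasure w z :=
          Measure.prod_apply_symm hset
      _ = ∫⁻ x, gammaPDF w z x * gammaMeasure ((n + 1 : ℕ) : ℝ) v (Set.Ioi x) :=
          lintegral_withDensity_eq_lintegral_mul _ (hmeas w z) htail
      _ = ∫⁻ x, ∑ k ∈ Finset.range (n + 1), ENNReal.ofReal (c k) * gammaPDF (k + w) (v + z) x :=
          lintegral_congr_ae hdens
      _ = ∑ k ∈ Finset.range (n + 1), ENNReal.ofReal (c k) := by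
          rw [lintegral_finsetSum _ fun k _ ↦ (hmeas _ _).const_mul _]
          refine Finset.sum_congr rfl fun k _ ↦ ?_
          rw [lintegral_const_mul _ (hmeas _ _), lintegral_gammaPDF_eq_one (by positivity) hvz,
            mul_one]
      _ = _ := (ENNReal.ofReal_sum_of_nonneg fun k _ ↦ hc0 k).symm
  rw [hprod, ENNReal.toReal_ofReal (Finset.sum_nonneg fun k _ ↦ hc0 k)]
end

section
/- Let n be a positive integer and let α, β, μ be real numbers with α > 0, β > 0, μ > 0. Let Y_n ~ Gamma(n, μ), Y_{n+1} ~ Gamma(n+1, μ) and X ~ Gamma(α, β), where Y_n is independent of X and Y_{n+1} is independent of X. Then P(Y_{n+1} > X) − P(Y_n > X) = (Γ(n+α)/(Γ(n+1)·Γ(α))) · (μ/(μ+β))^n · (β/(μ+β))^α. (This is the probability that exactly n service completions, each of duration Exp(μ), occur during one Gamma(α, β)-distributed packet interarrival time.) -/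
open MeasureTheory ProbabilityTheory

open Set Filter Topology

namespace ProbabilityTheory

lemma integrable_gammaPDFReal {a r : ℝ} (ha : 0 < a) (hr : 0 < r) :
    Integrable (gammaPDFReal a r) := by
  refine (lintegral_ofReal_ne_top_iff_integrable
    (measurable_gammaPDFReal a r).aestronglyMeasurable
    (ae_of_all _ (gammaPDFReal_nonneg ha hr))).mp ?_
  change ∫⁻ x, gammaPDF a r x ≠ ⊤
  simp [lintegral_gammaPDF_eq_one ha hr]

lemma gammaMeasure_apply {a r : ℝ} (ha : 0 < a) (hr : 0 < r) {s : Set ℝ}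
    (hs : MeasurableSet s) :
    gammaMeasure a r s = ENNReal.ofReal (∫ x in s, gammaPDFReal a r x) := by
  rw [gammaMeasure, withDensity_apply _ hs, ofReal_integral_eq_lintegral_ofReal
    (integrable_gammaPDFReal ha hr).integrableOn (ae_of_all _ (gammaPDFReal_nonneg ha hr))]
  rfl

lemma integral_Ioi_gammaPDFReal_add_one_sub {a r x : ℝ} (ha : 0 < a) (hr : 0 < r)
    (hx : 0 < x) :
    (∫ t in Ioi x, gammaPDFReal (a + 1) r t) - ∫ t in Ioi x, gammaPDFReal a r t =
      r ^ a / Real.Gamma (a + 1) * (x ^ a * Real.exp (-r * x)) := by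
  have ha1 : 0 < a + 1 := by linarith
  have hint : IntegrableOn (fun t ↦ gammaPDFReal (a + 1) r t - gammaPDFReal a r t) (Ioi x) :=
    ((integrable_gammaPDFReal ha1 hr).sub (integrable_gammaPDFReal ha hr)).integrableOn
  have hderiv : ∀ t ∈ Ici x,
      HasDerivAt (fun t ↦ -(r ^ a / Real.Gamma (a + 1)) * (t ^ a * Real.exp (-r * t)))
        (gammaPDFReal (a + 1) r t - gammaPDFReal a r t) t := by
    intro t ht
    have ht0 : 0 < t := hx.trans_le ht
    have hexp : HasDerivAt (fun t ↦ Real.exp (-r * t)) (Real.exp (-r * t) * (-r * 1)) t :=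
      ((hasDerivAt_id t).const_mul (-r)).exp
    convert! (((Real.hasDerivAt_rpow_const (p := a) (Or.inl ht0.ne')).mul hexp).const_mul
      (-(r ^ a / Real.Gamma (a + 1)))) using 1
    have hG := (Real.Gamma_pos_of_pos ha).ne'
    simp only [gammaPDFReal, if_pos ht0.le, Real.Gamma_add_one ha.ne', Real.rpow_add_one hr.ne',
      add_sub_cancel_right, neg_mul]
    field_simp
    ring
  have hlim : Tendsto (fun t ↦ -(r ^ a / Real.Gamma (a + 1)) * (t ^ a * Real.exp (-r * t)))
      atTop (𝓝 0) := by
    simpa using (tendsto_rpow_mul_exp_neg_mul_atTop_nhds_zero a r hr).const_mul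
      (-(r ^ a / Real.Gamma (a + 1)))
  rw [← integral_sub (integrable_gammaPDFReal ha1 hr).integrableOn
    (integrable_gammaPDFReal ha hr).integrableOn,
    integral_Ioi_of_hasDerivAt_of_tendsto' hderiv hint hlim]
  ring

lemma gammaMeasure_add_one_Ioi {a r x : ℝ} (ha : 0 < a) (hr : 0 < r) (hx : 0 < x) :
    gammaMeasure (a + 1) r (Ioi x) = gammaMeasure a r (Ioi x) +
      ENNReal.ofReal (r ^ a / Real.Gamma (a + 1) * (x ^ a * Real.exp (-r * x))) := by
  have ha1 : 0 < a + 1 := by linarith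
  rw [gammaMeasure_apply ha1 hr measurableSet_Ioi, gammaMeasure_apply ha hr measurableSet_Ioi,
    ← ENNReal.ofReal_add (integral_nonneg (gammaPDFReal_nonneg ha hr)) (by positivity),
    ← integral_Ioi_gammaPDFReal_add_one_sub ha hr hx, add_sub_cancel]

lemma gammaPDFReal_mul_rpow_mul_exp {a r α β x : ℝ} (hα : 0 < α) (ha : 0 < a) (hr : 0 < r)
    (hβ : 0 < β) (hx : 0 < x) :
    gammaPDFReal α β x * (r ^ a / Real.Gamma (a + 1) * (x ^ a * Real.exp (-r * x))) =
      Real.Gamma (a + α) / (Real.Gamma (a + 1) * Real.Gamma α) * (r / (r + β)) ^ a *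
        (β / (r + β)) ^ α * gammaPDFReal (a + α) (r + β) x := by
  have hrβ : 0 < r + β := by linarith
  have hG := (Real.Gamma_pos_of_pos (add_pos ha hα)).ne'
  have hGα := (Real.Gamma_pos_of_pos hα).ne'
  have hGa := (Real.Gamma_pos_of_pos (add_pos ha one_pos)).ne'
  have hexp : Real.exp (-((r + β) * x)) = Real.exp (-(β * x)) * Real.exp (-r * x) := by
    rw [← Real.exp_add]; ring_nf
  have hpow : x ^ (a + α - 1) = x ^ a * x ^ (α - 1) := by
    rw [← Real.rpow_add hx]; ring_nf
  simp only [gammaPDFReal, if_pos hx.le]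
  rw [hexp, hpow, Real.div_rpow hr.le hrβ.le, Real.div_rpow hβ.le hrβ.le, Real.rpow_add hrβ]
  field_simp

lemma gammaMeasure_prod_setOf_lt (a r α β : ℝ) [SFinite (gammaMeasure a r)]
    [SFinite (gammaMeasure α β)] :
    ((gammaMeasure a r).prod (gammaMeasure α β)) {p : ℝ × ℝ | p.2 < p.1} =
      ∫⁻ x, gammaPDF α β x * gammaMeasure a r (Ioi x) := by
  have hmeas : MeasurableSet {p : ℝ × ℝ | p.2 < p.1} :=
    measurableSet_lt measurable_snd measurable_fst
  have hf : Measurable fun x ↦ gammaMeasure a r (Ioi x) := measurable_measure_prodMk_right hmeas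
  rw [Measure.prod_apply_symm hmeas]
  exact lintegral_withDensity_eq_lintegral_mul _ (measurable_gammaPDFReal α β).ennreal_ofReal hf

lemma gammaMeasure_add_one_prod_setOf_lt {a r α β : ℝ} (ha : 0 < a) (hr : 0 < r) (hα : 0 < α)
    (hβ : 0 < β) :
    ((gammaMeasure (a + 1) r).prod (gammaMeasure α β)) {p : ℝ × ℝ | p.2 < p.1} =
      ((gammaMeasure a r).prod (gammaMeasure α β)) {p : ℝ × ℝ | p.2 < p.1} +
        ENNReal.ofReal (Real.Gamma (a + α) / (Real.Gamma (a + 1) * Real.Gamma α) *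
          (r / (r + β)) ^ a * (β / (r + β)) ^ α) := by
  have ha1 : 0 < a + 1 := by linarith
  have := isProbabilityMeasure_gammaMeasure ha1 hr
  have := isProbabilityMeasure_gammaMeasure ha hr
  have := isProbabilityMeasure_gammaMeasure hα hβ
  set c := Real.Gamma (a + α) / (Real.Gamma (a + 1) * Real.Gamma α) *
    (r / (r + β)) ^ a * (β / (r + β)) ^ α with hc
  have hc0 : 0 ≤ c := by
    have := Real.Gamma_pos_of_pos (add_pos ha hα)
    positivity
  have hpdf (b s : ℝ) : Measurable (gammaPDF b s) := (measurable_gammaPDFReal b s).ennreal_ofReal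
  have hae : ∀ᵐ x : ℝ, gammaPDF α β x * gammaMeasure (a + 1) r (Ioi x) =
      gammaPDF α β x * gammaMeasure a r (Ioi x) +
        ENNReal.ofReal c * gammaPDF (a + α) (r + β) x := by
    filter_upwards [Measure.ae_ne volume (0 : ℝ)] with x hx
    rcases hx.lt_or_gt with hx | hx
    · simp [gammaPDF_of_neg hx]
    · rw [gammaMeasure_add_one_Ioi ha hr hx, mul_add, gammaPDF, gammaPDF,
        ← ENNReal.ofReal_mul (gammaPDFReal_nonneg hα hβ x), ← ENNReal.ofReal_mul hc0,
        gammaPDFReal_mul_rpow_mul_exp hα ha hr hβ hx]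
  rw [gammaMeasure_prod_setOf_lt, gammaMeasure_prod_setOf_lt, lintegral_congr_ae hae,
    lintegral_add_right _ ((hpdf _ _).const_mul _), lintegral_const_mul _ (hpdf _ _),
    lintegral_gammaPDF_eq_one (add_pos ha hα) (add_pos hr hβ), mul_one]

end ProbabilityTheory

/-- The probability that exactly `n` service completions (sum of `n` i.i.d. `Exp(μ)`
services, i.e. `Gamma(n, μ)`) occur during one `Gamma(α, β)` interarrival time:
`P(Y_{n+1} > X) − P(Y_n > X) = Γ(n+α)/(Γ(n+1)Γ(α)) · (μ/(μ+β))^n · (β/(μ+β))^α`. -/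
theorem exactly_n_services_prob (n : ℕ) (hn : 0 < n) (α β μ : ℝ)
    (hα : 0 < α) (hβ : 0 < β) (hμ : 0 < μ) :
    (((gammaMeasure ((n : ℝ) + 1) μ).prod (gammaMeasure α β)) {p : ℝ × ℝ | p.2 < p.1}).toReal -
        (((gammaMeasure (n : ℝ) μ).prod (gammaMeasure α β)) {p : ℝ × ℝ | p.2 < p.1}).toReal =
      (Real.Gamma (n + α) / (Real.Gamma (n + 1) * Real.Gamma α)) *
        (μ / (μ + β)) ^ n * (β / (μ + β)) ^ α := by
  have hn0 : (0 : ℝ) < n := by exact_mod_cast hn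
  have := isProbabilityMeasure_gammaMeasure hn0 hμ
  have := isProbabilityMeasure_gammaMeasure hα hβ
  have hG := Real.Gamma_pos_of_pos (add_pos hn0 hα)
  rw [gammaMeasure_add_one_prod_setOf_lt hn0 hμ hα hβ,
    ENNReal.toReal_add (measure_ne_top _ _) ENNReal.ofReal_ne_top,
    ENNReal.toReal_ofReal (by positivity), Real.rpow_natCast]
  ring
end

section
/- Let n be a positive integer, let β_1, …, β_n be positive reals and c_1, …, c_n be nonnegative reals. Let W_1, …, W_n be independent random variables with W_j exponentially distributed with rate β_j, and set Y_k = W_k + c_k for each k. Fix an index j and real numbers a < b such that c_j ≤ a and, for every k ≠ j, either c_k ≤ a or c_k ≥ b. Let S = {k ≠ j : c_k ≤ a}. Then P(Y_j ∈ (a, b] and Y_k > Y_j for all k ≠ j) = ∫_a^b (Π_{k ∈ S} e^(−β_k (y − c_k))) · β_j · e^(−β_j (y − c_j)) dy. -/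
open MeasureTheory ProbabilityTheory

/-- Disintegration along the coordinate `j` of the event that every other coordinate exceeds a
threshold depending on the `j`-th one. -/
lemma measure_pi_setOf_mem_and_forall_lt {n : ℕ} (μ : Fin n → Measure ℝ)
    [∀ k, SigmaFinite (μ k)] (j : Fin n) {s : Set ℝ} (hs : MeasurableSet s)
    {f : Fin n → ℝ → ℝ} (hf : ∀ k, Measurable (f k)) :
    Measure.pi μ {ω | ω j ∈ s ∧ ∀ k, k ≠ j → f k (ω j) < ω k} =
      ∫⁻ x in s, ∏ k ∈ {j}ᶜ, μ k (Set.Ioi (f k x)) ∂μ j := by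
  obtain _ | m := n
  · exact j.elim0
  have hT : MeasurableSet
      {p : ℝ × (Fin m → ℝ) | p.1 ∈ s ∧ ∀ i, f (j.succAbove i) p.1 < p.2 i} := by
    refine (measurable_fst hs).inter ?_
    change MeasurableSet {p : ℝ × (Fin m → ℝ) | ∀ i, f (j.succAbove i) p.1 < p.2 i}
    rw [Set.ofPred_forall]
    refine MeasurableSet.iInter fun i => ?_
    exact measurableSet_lt ((hf _).comp measurable_fst)
      ((measurable_pi_apply i).comp measurable_snd)
  have hpre : {ω : Fin (m + 1) → ℝ | ω j ∈ s ∧ ∀ k, k ≠ j → f k (ω j) < ω k} =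
      MeasurableEquiv.piFinSuccAbove (fun _ => ℝ) j ⁻¹'
        {p | p.1 ∈ s ∧ ∀ i, f (j.succAbove i) p.1 < p.2 i} := by
    ext ω
    simp [j.forall_iff_succAbove, Fin.removeNth]
  rw [hpre, (measurePreserving_piFinSuccAbove μ j).measure_preimage hT.nullMeasurableSet,
    Measure.prod_apply hT, ← lintegral_indicator hs]
  refine lintegral_congr fun x => ?_
  by_cases hx : x ∈ s
  · have hsec : Prod.mk x ⁻¹' {p : ℝ × (Fin m → ℝ) | p.1 ∈ s ∧
        ∀ i, f (j.succAbove i) p.1 < p.2 i} =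
        Set.univ.pi fun i => Set.Ioi (f (j.succAbove i) x) := by
      ext
      simp [hx]
    rw [hsec, Measure.pi_pi, Set.indicator_of_mem hx, ← Fin.image_succAbove_univ,
      Finset.prod_image (Fin.succAbove_right_injective.injOn)]
  · simp [hx]

lemma expMeasure_Ioi {r : ℝ} (hr : 0 < r) (x : ℝ) :
    expMeasure r (Set.Ioi x) = ENNReal.ofReal (if 0 ≤ x then Real.exp (-(r * x)) else 1) := by
  have := isProbabilityMeasure_expMeasure hr
  rw [← ofReal_measureReal, ← Set.compl_Iic, probReal_compl_eq_one_sub measurableSet_Iic,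
    ← cdf_eq_real, cdf_expMeasure_eq hr]
  split_ifs <;> simp

lemma expMeasure_Ioi_of_nonneg {r x : ℝ} (hr : 0 < r) (hx : 0 ≤ x) :
    expMeasure r (Set.Ioi x) = ENNReal.ofReal (Real.exp (-(r * x))) := by
  rw [expMeasure_Ioi hr, if_pos hx]

lemma expMeasure_Ioi_of_nonpos {r x : ℝ} (hr : 0 < r) (hx : x ≤ 0) :
    expMeasure r (Set.Ioi x) = 1 := by
  rw [expMeasure_Ioi hr]
  split_ifs with h
  · simp [le_antisymm hx h]
  · simp

lemma measurable_exponentialPDF (r : ℝ) : Measurable (exponentialPDF r) :=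
  (measurable_exponentialPDFReal r).ennreal_ofReal



/-- Probability that the next decision epoch falls in `(a, b]` and involves flow `j`:
with `W_k ~ Exp(β_k)` independent, `Y_k = W_k + c_k`, `c_j ≤ a < b` and every other
`c_k` outside `(a, b)`, we have
`P(Y_j ∈ (a,b], ∀ k ≠ j, Y_k > Y_j)
  = ∫_a^b (Π_{k ∈ S} e^{−β_k (y−c_k)}) β_j e^{−β_j (y−c_j)} dy`,
where `S = {k ≠ j : c_k ≤ a}`. -/
theorem next_decision_epoch_prob (n : ℕ) (hn : 0 < n)
    (β c : Fin n → ℝ) (hβ : ∀ k, 0 < β k) (hc : ∀ k, 0 ≤ c k)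
    (j : Fin n) (a b : ℝ) (hab : a < b) (hcj : c j ≤ a)
    (hsep : ∀ k, k ≠ j → c k ≤ a ∨ b ≤ c k) :
    ((Measure.pi fun k => expMeasure (β k))
        {ω : Fin n → ℝ | ω j + c j ∈ Set.Ioc a b ∧
          ∀ k, k ≠ j → ω j + c j < ω k + c k}).toReal =
      ∫ y in a..b,
        (∏ k ∈ Finset.univ.filter (fun k => k ≠ j ∧ c k ≤ a),
            Real.exp (-(β k) * (y - c k))) *
          (β j * Real.exp (-(β j) * (y - c j))) := by
  have hprob k := isProbabilityMeasure_expMeasure (hβ k)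
  set F : ℝ → ℝ := fun y =>
    (∏ k ∈ Finset.univ.filter (fun k => k ≠ j ∧ c k ≤ a), Real.exp (-(β k) * (y - c k))) *
      (β j * Real.exp (-(β j) * (y - c j))) with hF
  have hFcont : Continuous F := by fun_prop
  have hFnonneg y : 0 ≤ F y := by have := (hβ j).le; positivity
  have hpre : MeasurableSet ((· + c j) ⁻¹' Set.Ioc a b) := measurable_add_const _ measurableSet_Ioc
  have hset : {ω : Fin n → ℝ | ω j + c j ∈ Set.Ioc a b ∧
      ∀ k, k ≠ j → ω j + c j < ω k + c k} =
      {ω | ω j ∈ (· + c j) ⁻¹' Set.Ioc a b ∧ ∀ k, k ≠ j → ω j + c j - c k < ω k} := by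
    simp only [sub_lt_iff_lt_add, Set.mem_preimage]
  have htail {y : ℝ} (hy : y ∈ Set.Ioc a b) :
      ∏ k ∈ {j}ᶜ, expMeasure (β k) (Set.Ioi (y - c k)) =
        ENNReal.ofReal (∏ k ∈ Finset.univ.filter (fun k => k ≠ j ∧ c k ≤ a),
          Real.exp (-(β k) * (y - c k))) := by
    have hsub : Finset.univ.filter (fun k => k ≠ j ∧ c k ≤ a) ⊆ {j}ᶜ := fun k hk => by
      simp_all
    rw [ENNReal.ofReal_prod_of_nonneg fun _ _ => (Real.exp_pos _).le,
      ← Finset.prod_subset hsub]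
    · refine Finset.prod_congr rfl fun k hk => ?_
      have hk' : c k ≤ a := (Finset.mem_filter.1 hk).2.2
      rw [expMeasure_Ioi_of_nonneg (hβ k) (by linarith [hy.1]), neg_mul]
    · intro k hk hkS
      have hkj : k ≠ j := by simpa using hk
      have hbk : b ≤ c k := (hsep k hkj).resolve_left fun h => hkS (by simp [hkj, h])
      exact expMeasure_Ioi_of_nonpos (hβ k) (by linarith [hy.2])
  have hmeas : Measurable fun x =>
      ∏ k ∈ {j}ᶜ, expMeasure (β k) (Set.Ioi (x + c j - c k)) := by
    refine Finset.measurable_prod _ fun k _ => ?_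
    have : Antitone fun x => expMeasure (β k) (Set.Ioi (x + c j - c k)) := fun x y hxy =>
      measure_mono (Set.Ioi_subset_Ioi (by linarith))
    exact this.measurable
  rw [hset, measure_pi_setOf_mem_and_forall_lt _ j hpre (f := fun k x => x + c j - c k)
    fun k => by fun_prop, intervalIntegral.integral_of_le hab.le,
    integral_eq_lintegral_of_nonneg_ae (.of_forall hFnonneg) hFcont.aestronglyMeasurable,
    ← (measurePreserving_add_right volume (c j)).setLIntegral_comp_preimage measurableSet_Ioc
      hFcont.measurable.ennreal_ofReal]
  change (∫⁻ x in _, _ ∂(volume.withDensity (exponentialPDF (β j)))).toReal = _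
  rw [setLIntegral_withDensity_eq_setLIntegral_mul _ (measurable_exponentialPDF _) hmeas hpre]
  refine congrArg _ (setLIntegral_congr_fun hpre fun x hx => ?_)
  have hx0 : 0 ≤ x := by linarith [hx.1]
  rw [Pi.mul_apply, htail hx, exponentialPDF_of_nonneg hx0, mul_comm,
    ← ENNReal.ofReal_mul (Finset.prod_nonneg fun _ _ => (Real.exp_pos _).le)]
  simp [hF]
end
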